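/- arXiv:1003.2454 — 3 statements merged into one kernel-verified Lean document; each statement's English description precedes it below -/
import Mathlib

section
/- Let p1, p2 be real numbers with 0 < p1, 0 < p2 and p1 + p2 = 1, let C ∈ (0, 1], p ∈ [0, 1], R_H ∈ [0, 1), g11 > 0, g21 ∈ (0, 1), aL ≥ 0, aR ≥ 0 and ε ∈ (0, 1). Define C̄ = (1 - p2 · p) · C, A = (1/(2 · log 2)) · ((p1 · g11 + (1-R_H) · p2) / (p1 + (1-R_H) · p2)), and w = (p1 · g11 · aL + (1-R_H) · p2 · aR) / (p1 · g11 + (1-R_H) · p2). Assume A · g21^w < 1 and that (1-ε) · C̄ ≤ 1 - (1 - C̄) / (1 - A · g21^w). Then w ≥ log( A · (1 - (1-ε) · C̄) / (ε · C̄) ) / log(1 / g21). -/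
/-- (Corollary 1 of the paper: lower bound on the weighted
average degree `w` of the LDGM accumulate nodes and LDPC check nodes when the
design rate is `(1-ε)·C̄`, with `C̄ = (1 - p2·p)·C` the capacity after
puncturing). -/
theorem average_degree_lower_bound (p1 p2 C p RH g11 g21 aL aR ε : ℝ)
    (hp1 : 0 < p1) (hp2 : 0 < p2) (hsum : p1 + p2 = 1)
    (hC : 0 < C) (hC1 : C ≤ 1) (hp : 0 ≤ p) (hp' : p ≤ 1)
    (hRH : 0 ≤ RH) (hRH' : RH < 1)
    (hg11 : 0 < g11) (hg21 : 0 < g21) (hg21' : g21 < 1)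
    (haL : 0 ≤ aL) (haR : 0 ≤ aR) (hε : 0 < ε) (hε' : ε < 1)
    (Cbar A w : ℝ)
    (hCbar : Cbar = (1 - p2 * p) * C)
    (hA : A = (1 / (2 * Real.log 2)) *
      ((p1 * g11 + (1 - RH) * p2) / (p1 + (1 - RH) * p2)))
    (hw : w = (p1 * g11 * aL + (1 - RH) * p2 * aR) / (p1 * g11 + (1 - RH) * p2))
    (hlt : A * g21 ^ w < 1)
    (hineq : (1 - ε) * Cbar ≤ 1 - (1 - Cbar) / (1 - A * g21 ^ w)) :
    w ≥ Real.log (A * (1 - (1 - ε) * Cbar) / (ε * Cbar)) / Real.log (1 / g21) := by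
  have hlog : 0 < Real.log (1 / g21) := Real.log_pos ((one_lt_div hg21).2 hg21')
  have hRH1 : 0 < 1 - RH := by linarith
  have hlog2 : 0 < Real.log 2 := Real.log_pos (by norm_num)
  have hApos : 0 < A := by rw [hA]; positivity
  have hp2p : p2 * p < 1 := by nlinarith
  have hCbar0 : 0 < Cbar := by rw [hCbar]; exact mul_pos (by linarith) hC
  have hCbar1 : Cbar ≤ 1 := by
    rw [hCbar]
    exact mul_le_one₀ (by linarith [mul_nonneg hp2.le hp]) hC.le hC1
  have hD : 0 < 1 - (1 - ε) * Cbar := by nlinarith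
  have hεC : 0 < ε * Cbar := mul_pos hε hCbar0
  have hpow : 0 < g21 ^ w := Real.rpow_pos_of_pos hg21 w
  have hquot : 1 - Cbar ≤ (1 - (1 - ε) * Cbar) * (1 - A * g21 ^ w) :=
    (div_le_iff₀ (by linarith)).1 (by linarith)
  have hbound : A * (1 - (1 - ε) * Cbar) / (ε * Cbar) ≤ (g21 ^ w)⁻¹ := by
    rw [div_le_iff₀ hεC, ← div_eq_inv_mul, le_div_iff₀ hpow]
    linarith
  rw [ge_iff_le, div_le_iff₀ hlog]
  calc Real.log (A * (1 - (1 - ε) * Cbar) / (ε * Cbar))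
      ≤ Real.log (g21 ^ w)⁻¹ := Real.log_le_log (by positivity) hbound
    _ = w * Real.log (1 / g21) := by
      rw [Real.log_inv, Real.log_rpow hg21, one_div, Real.log_inv, mul_neg]
end

section
/- Let κ > 0, g1 > 0, let p1, p2 ∈ (0, 1) with p1 + p2 = 1, let R_H ∈ [0, 1), g11 > 0 and C ∈ (0, 1]. Define A = (1/(2 · log 2)) · ((p1 · g11 + (1-R_H) · p2) / (p1 + (1-R_H) · p2)) and, for ε > 0, define C̄(ε) = (1 - p2 · (1 - κ·ε)) · C and f(ε) = log( A · (1 - (1-ε) · C̄(ε)) / (ε · C̄(ε)) ) / log( 1 / (κ · g1 · ε) ). Then f(ε) tends to 1 as ε tends to 0 from the right; in particular the lower bound on the average degrees of Corollary 1 with puncturing probability p = 1 - κ·ε remains bounded as ε → 0⁺. -/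
open Filter Topology

/-- If `h` has a nonzero limit at `0⁺` and `0 < c`, then `log (h ε / ε)` and `log (1 / (c * ε))`
are asymptotically equal as `ε → 0⁺`. -/
theorem tendsto_log_div_div_log_one_div {h : ℝ → ℝ} {L c : ℝ}
    (hh : Tendsto h (𝓝[>] 0) (𝓝 L)) (hL : L ≠ 0) (hc : 0 < c) :
    Tendsto (fun ε => Real.log (h ε / ε) / Real.log (1 / (c * ε))) (𝓝[>] 0) (𝓝 1) := by
  have hden : Tendsto (fun ε => Real.log (1 / (c * ε))) (𝓝[>] 0) atTop := by
    refine Real.tendsto_log_atTop.comp ?_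
    simpa [mul_comm] using tendsto_inv_nhdsGT_zero.const_mul_atTop (inv_pos.mpr hc)
  have hnum : Tendsto (fun ε => Real.log (h ε * c)) (𝓝[>] 0) (𝓝 (Real.log (L * c))) :=
    (hh.mul_const c).log (mul_ne_zero hL hc.ne')
  have hsum : Tendsto (fun ε => 1 + Real.log (h ε * c) / Real.log (1 / (c * ε)))
      (𝓝[>] 0) (𝓝 1) := by
    simpa using (hnum.div_atTop hden).const_add 1
  refine hsum.congr' ?_
  filter_upwards [hden.eventually_gt_atTop 0, hh.eventually_ne hL, self_mem_nhdsWithin]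
    with ε hlog hne hε
  have hε0 : ε ≠ 0 := ne_of_gt hε
  have hsplit : h ε / ε = h ε * c * (1 / (c * ε)) := by
    field_simp
  rw [hsplit, Real.log_mul (mul_ne_zero hne hc.ne') (by positivity), add_div,
    div_self hlog.ne', add_comm]

/-- Lemma 3 of the paper. With puncturing probability
`p = 1 - κε`, so `g_{2,1} = κ·g1·ε` and effective capacity
`C̄(ε) = (1 - p2·(1-κε))·C`, the lower bound of Corollary 1,
`f(ε) = log(A·(1-(1-ε)·C̄(ε))/(ε·C̄(ε))) / log(1/(κ·g1·ε))`,
tends to `1` as `ε → 0⁺`; in particular it stays bounded, so capacity can be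
approached with bounded complexity. -/
theorem degree_bound_tendsto_one (κ g1 p1 p2 RH g11 C : ℝ)
    (hκ : 0 < κ) (hg1 : 0 < g1)
    (hp1 : 0 < p1) (hp1' : p1 < 1) (hp2 : 0 < p2) (hp2' : p2 < 1)
    (hsum : p1 + p2 = 1) (hRH : 0 ≤ RH) (hRH' : RH < 1)
    (hg11 : 0 < g11) (hC : 0 < C) (hC1 : C ≤ 1)
    (A : ℝ)
    (hA : A = (1 / (2 * Real.log 2)) *
      ((p1 * g11 + (1 - RH) * p2) / (p1 + (1 - RH) * p2)))
    (Cbar f : ℝ → ℝ)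
    (hCbar : ∀ ε, Cbar ε = (1 - p2 * (1 - κ * ε)) * C)
    (hf : ∀ ε, f ε = Real.log (A * (1 - (1 - ε) * Cbar ε) / (ε * Cbar ε)) /
      Real.log (1 / (κ * g1 * ε))) :
    Tendsto f (𝓝[>] (0 : ℝ)) (𝓝 1) := by
  have hA0 : 0 < A := by
    have hRH0 : 0 < 1 - RH := sub_pos.mpr hRH'
    have hlog : 0 < Real.log 2 := Real.log_pos one_lt_two
    rw [hA]
    positivity
  have hC0 : Cbar 0 = p1 * C := by
    rw [hCbar, eq_sub_of_add_eq hsum]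
    ring
  have hC0_pos : 0 < Cbar 0 := hC0 ▸ mul_pos hp1 hC
  have hC0_lt : Cbar 0 < 1 := by
    rw [hC0]
    nlinarith
  have hcont : Continuous Cbar := by
    rw [funext hCbar]
    fun_prop
  have hlim : Tendsto (fun ε => A * (1 - (1 - ε) * Cbar ε) / Cbar ε) (𝓝[>] 0)
      (𝓝 (A * (1 - (1 - 0) * Cbar 0) / Cbar 0)) := by
    have hat : ContinuousAt (fun ε => A * (1 - (1 - ε) * Cbar ε) / Cbar ε) 0 :=
      ContinuousAt.div (by fun_prop) hcont.continuousAt hC0_pos.ne'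
    exact hat.tendsto.mono_left nhdsWithin_le_nhds
  have hlim_ne : A * (1 - (1 - 0) * Cbar 0) / Cbar 0 ≠ 0 := by
    rw [sub_zero, one_mul]
    exact (div_pos (mul_pos hA0 (sub_pos.mpr hC0_lt)) hC0_pos).ne'
  refine (tendsto_log_div_div_log_one_div hlim hlim_ne (mul_pos hκ hg1)).congr fun ε => ?_
  rw [hf, div_div, mul_comm (Cbar ε)]
end

section
/- Let λG, ρG, λH, ρH, LG, LH, RG : ℝ → ℝ be differentiable functions satisfying the normalizations ρG(1) = 1, RG(1) = 1, ρH(1) = 1, LG(0) = 0 and LH(0) = 0. Let δ, p ∈ ℝ and set D = 1 - (1-δ)·(1-p). Define u(x2) = 1 - (1 - δ·(1 - RG(1 - x2))) · ρG(1 - x2), v(x3) = 1 - ρH(1 - x3), and the density-evolution maps ψA(x2, x3) = D · λG(u(x2)) · LH(v(x3)) and ψB(x2, x3) = D · LG(u(x2)) · λH(v(x3)). Then: (i) ψA(0,0) = 0 and ψB(0,0) = 0, so (0,0) is a fixed point; (ii) ∂ψA/∂x2 (0,0) = 0 and ∂ψB/∂x3 (0,0) = 0; (iii) ∂ψA/∂x3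 (0,0) = D · λG(0) · LH'(0) · ρH'(1) and ∂ψB/∂x2 (0,0) = D · LG'(0) · λH(0) · (δ · RG'(1) + ρG'(1)); and consequently (iv) the linearization coefficient ∂ψA/∂x2 (0,0) + ∂ψA/∂x3 (0,0) · (∂ψB/∂x2 (0,0)) / (1 - ∂ψB/∂x3 (0,0)) equals D² · λG(0) · LG'(0) · ρH'(1) · λH(0) · LH'(0) · (δ · RG'(1) + ρG'(1)). In particular, this coefficient is strictly less than 1 (the stability condition of density evolution at the fixed point x2 = 0) if and only if D² · λG(0) · LG'(0) · ρH'(1) · λH(0) · LH'(0) · (δ · RG'(1) + ρG'(1)) < 1. -/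
/-- computational content of Theorem 3 of the paper: the
stability condition at the fixed point `x2 = 0` of density evolution for
punctured LDGM-LDPC codes over the BEC. -/
theorem stability_condition_bec
    (lamG rhoG lamH rhoH LG LH RG : ℝ → ℝ)
    (hlamG : Differentiable ℝ lamG) (hrhoG : Differentiable ℝ rhoG)
    (hlamH : Differentiable ℝ lamH) (hrhoH : Differentiable ℝ rhoH)
    (hLG : Differentiable ℝ LG) (hLH : Differentiable ℝ LH)
    (hRG : Differentiable ℝ RG)
    (hrhoG1 : rhoG 1 = 1) (hRG1 : RG 1 = 1) (hrhoH1 : rhoH 1 = 1)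
    (hLG0 : LG 0 = 0) (hLH0 : LH 0 = 0)
    (δ p D : ℝ) (hD : D = 1 - (1 - δ) * (1 - p))
    (u v : ℝ → ℝ)
    (hu : ∀ x2, u x2 = 1 - (1 - δ * (1 - RG (1 - x2))) * rhoG (1 - x2))
    (hv : ∀ x3, v x3 = 1 - rhoH (1 - x3))
    (ψA ψB : ℝ → ℝ → ℝ)
    (hψA : ∀ x2 x3, ψA x2 x3 = D * lamG (u x2) * LH (v x3))
    (hψB : ∀ x2 x3, ψB x2 x3 = D * LG (u x2) * lamH (v x3)) :
    -- (i) (0,0) is a fixed point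
    ψA 0 0 = 0 ∧ ψB 0 0 = 0 ∧
    -- (ii) the diagonal partial derivatives vanish
    deriv (fun x2 => ψA x2 0) 0 = 0 ∧
    deriv (fun x3 => ψB 0 x3) 0 = 0 ∧
    -- (iii) the off-diagonal partial derivatives
    deriv (fun x3 => ψA 0 x3) 0 = D * lamG 0 * deriv LH 0 * deriv rhoH 1 ∧
    deriv (fun x2 => ψB x2 0) 0 =
      D * deriv LG 0 * lamH 0 * (δ * deriv RG 1 + deriv rhoG 1) ∧
    -- (iv) the linearization coefficient
    deriv (fun x2 => ψA x2 0) 0 +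
        deriv (fun x3 => ψA 0 x3) 0 * deriv (fun x2 => ψB x2 0) 0 /
          (1 - deriv (fun x3 => ψB 0 x3) 0) =
      D ^ 2 * lamG 0 * deriv LG 0 * deriv rhoH 1 * lamH 0 * deriv LH 0 *
        (δ * deriv RG 1 + deriv rhoG 1) ∧
    -- the stability condition
    (deriv (fun x2 => ψA x2 0) 0 +
        deriv (fun x3 => ψA 0 x3) 0 * deriv (fun x2 => ψB x2 0) 0 /
          (1 - deriv (fun x3 => ψB 0 x3) 0) < 1 ↔
      D ^ 2 * lamG 0 * deriv LG 0 * deriv rhoH 1 * lamH 0 * deriv LH 0 *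
        (δ * deriv RG 1 + deriv rhoG 1) < 1) := by
  have hu0 : u 0 = 0 := by simp [hu, hrhoG1, hRG1]
  have hv0 : v 0 = 0 := by simp [hv, hrhoH1]
  have refl_deriv : ∀ f : ℝ → ℝ, Differentiable ℝ f →
      HasDerivAt (fun x => f (1 - x)) (-deriv f 1) 0 := fun f hf => by
    have h : HasDerivAt f (deriv f 1) (1 - 0) := by
      simpa using (hf 1).hasDerivAt
    exact h.comp_const_sub 1 0
  have hu' : HasDerivAt u (δ * deriv RG 1 + deriv rhoG 1) 0 := by
    rw [funext hu]
    refine ((((((refl_deriv RG hRG).const_sub 1).const_mul δ).const_sub 1).mul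
      (refl_deriv rhoG hrhoG)).const_sub 1).congr_deriv ?_
    simp only [sub_zero, hRG1, hrhoG1]
    ring
  have hv' : HasDerivAt v (deriv rhoH 1) 0 := by
    rw [funext hv]
    exact ((refl_deriv rhoH hrhoH).const_sub 1).congr_deriv (neg_neg _)
  have comp_deriv : ∀ (f w : ℝ → ℝ) (w' : ℝ), Differentiable ℝ f → w 0 = 0 →
      HasDerivAt w w' 0 → HasDerivAt (fun x => f (w x)) (deriv f 0 * w') 0 :=
    fun f w w' hf hw0 hw => by
      have h : HasDerivAt f (deriv f 0) (w 0) := by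
        simpa [hw0] using (hf 0).hasDerivAt
      exact h.comp 0 hw
  have hA2 : deriv (fun x2 => ψA x2 0) 0 = 0 := by simp [hψA, hv0, hLH0]
  have hB3 : deriv (fun x3 => ψB 0 x3) 0 = 0 := by simp [hψB, hu0, hLG0]
  have hA3 : deriv (fun x3 => ψA 0 x3) 0 =
      D * lamG 0 * deriv LH 0 * deriv rhoH 1 := by
    simp only [hψA, hu0]
    rw [((comp_deriv LH v _ hLH hv0 hv').const_mul (D * lamG 0)).deriv]
    ring
  have hB2 : deriv (fun x2 => ψB x2 0) 0 =
      D * deriv LG 0 * lamH 0 * (δ * deriv RG 1 + deriv rhoG 1) := by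
    simp only [hψB, hv0]
    rw [(((comp_deriv LG u _ hLG hu0 hu').const_mul D).mul_const (lamH 0)).deriv]
    ring
  have hcoeff : deriv (fun x2 => ψA x2 0) 0 +
        deriv (fun x3 => ψA 0 x3) 0 * deriv (fun x2 => ψB x2 0) 0 /
          (1 - deriv (fun x3 => ψB 0 x3) 0) =
      D ^ 2 * lamG 0 * deriv LG 0 * deriv rhoH 1 * lamH 0 * deriv LH 0 *
        (δ * deriv RG 1 + deriv rhoG 1) := by
    rw [hA2, hB3, hA3, hB2]
    ring
  exact ⟨by simp [hψA, hv0, hLH0], by simp [hψB, hu0, hLG0], hA2, hB3, hA3, hB2, hcoeff,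
    by rw [hcoeff]⟩
end
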